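/- arXiv:0807.0620 — 2 statements merged into one kernel-verified Lean document; each statement's English description precedes it below -/
import Mathlib

section
/- Under the stated Bessel transformation property and the Hecke relations, for every integer m ≥ 1 one has B(h(−1, m)·t₃) = w_p·ψ_p(−c/p)·p^{−(4m−2)}. -/
open Matrix

noncomputable section

variable (p : ℕ) [Fact p.Prime]

/-- The 4×4 symplectic similitude matrix `J`. -/
def Jmat : Matrix (Fin 4) (Fin 4) ℚ_[p] :=
  !![0,0,1,0; 0,0,0,1; -1,0,0,0; 0,-1,0,0]

/-- `GSp₄(ℚ_p)`. -/
def GSp4 : Set (Matrix (Fin 4) (Fin 4) ℚ_[p]) :=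
  {g | IsUnit g.det ∧ ∃ μ : ℚ_[p]ˣ, gᵀ * Jmat p * g = (μ : ℚ_[p]) • Jmat p}

/-- `K_p = GSp₄(ℤ_p)`, viewed inside `GSp₄(ℚ_p)`. -/
def Kp : Set (Matrix (Fin 4) (Fin 4) ℚ_[p]) :=
  {g | g ∈ GSp4 p ∧ (∀ i j, ‖g i j‖ ≤ 1) ∧ ‖g.det‖ = 1}

/-- The Iwahori subgroup `I_p`: elements of `K_p` whose reduction mod `p` has zero
entries at positions (1,2), (3,1), (3,2), (4,1), (4,2), (4,3) (0-indexed below). -/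
def Ip : Set (Matrix (Fin 4) (Fin 4) ℚ_[p]) :=
  {g | g ∈ Kp p ∧ ‖g 0 1‖ < 1 ∧ ‖g 2 0‖ < 1 ∧ ‖g 2 1‖ < 1 ∧
      ‖g 3 0‖ < 1 ∧ ‖g 3 1‖ < 1 ∧ ‖g 3 2‖ < 1}

/-- The matrix `U_x` for `x = (n,q,r)`. -/
def Umat (n q r : ℚ_[p]) : Matrix (Fin 4) (Fin 4) ℚ_[p] :=
  !![1,0,n,q; 0,1,q,r; 0,0,1,0; 0,0,0,1]

/-- The matrix `Z_y` for `y ∈ ℤ_p`. -/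
def Zmat (y : ℚ_[p]) : Matrix (Fin 4) (Fin 4) ℚ_[p] :=
  !![1,y,0,0; 0,1,0,0; 0,0,1,0; 0,0,-y,1]

/-- The matrix `Z_∞`. -/
def Zinf : Matrix (Fin 4) (Fin 4) ℚ_[p] :=
  !![0,1,0,0; 1,0,0,0; 0,0,0,1; 0,0,1,0]

/-- `Z_v` for `v ∈ V = Y ∪ {∞}`, where `Y = {0,…,p−1}` is modelled by `Fin p`
and `∞` by `none`. -/
def ZV : Option (Fin p) → Matrix (Fin 4) (Fin 4) ℚ_[p]
  | some y => Zmat p (y.val : ℚ_[p])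
  | none => Zinf p

/-- Class A matrices `A_x^y = U_x · J · Z_y`. -/
def Amat (x : Fin p × Fin p × Fin p) (v : Option (Fin p)) : Matrix (Fin 4) (Fin 4) ℚ_[p] :=
  Umat p (x.1.val : ℚ_[p]) (x.2.1.val : ℚ_[p]) (x.2.2.val : ℚ_[p]) * Jmat p * ZV p v

/-- Class B matrices `B_x^y = J · U_x · J · Z_y`. -/
def Bmat (x : Fin p × Fin p × Fin p) (v : Option (Fin p)) : Matrix (Fin 4) (Fin 4) ℚ_[p] :=
  Jmat p * Umat p (x.1.val : ℚ_[p]) (x.2.1.val : ℚ_[p]) (x.2.2.val : ℚ_[p]) * Jmat p * ZV p v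

/-- Assemble a 4×4 matrix from 2×2 blocks. -/
def blk (A B C D : Matrix (Fin 2) (Fin 2) ℚ_[p]) : Matrix (Fin 4) (Fin 4) ℚ_[p] :=
  Matrix.reindex finSumFinEquiv finSumFinEquiv (fromBlocks A B C D)

variable (a b c : ℚ_[p])

/-- The matrix `S = (a, b/2; b/2, c)`. -/
def Smat : Matrix (Fin 2) (Fin 2) ℚ_[p] := !![a, b/2; b/2, c]

/-- The matrix `ξ = (b/2, c; −a, −b/2)`. -/
def xiS : Matrix (Fin 2) (Fin 2) ℚ_[p] := !![b/2, c; -a, -b/2]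

/-- The torus `T(ℚ_p) = {g ∈ GL₂(ℚ_p) : gᵀSg = det(g)·S}`. -/
def Tgrp : Set (Matrix (Fin 2) (Fin 2) ℚ_[p]) :=
  {g | IsUnit g.det ∧ gᵀ * Smat p a b c * g = g.det • Smat p a b c}

/-- The embedding `g ↦ diag(g, det(g)·(g⁻¹)ᵀ)` of `GL₂` into `GSp₄`. -/
def emb (g : Matrix (Fin 2) (Fin 2) ℚ_[p]) : Matrix (Fin 4) (Fin 4) ℚ_[p] :=
  blk p g 0 0 (g.det • (g⁻¹)ᵀ)

/-- The unipotent group `U(ℚ_p)`. -/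
def Ugrp : Set (Matrix (Fin 4) (Fin 4) ℚ_[p]) :=
  {u | ∃ X : Matrix (Fin 2) (Fin 2) ℚ_[p], Xᵀ = X ∧ u = blk p 1 X 0 1}

/-- The Bessel group `R(ℚ_p) = T(ℚ_p)·U(ℚ_p)` inside `GSp₄(ℚ_p)`. -/
def Rgrp : Set (Matrix (Fin 4) (Fin 4) ℚ_[p]) :=
  {r | ∃ t ∈ Tgrp p a b c, ∃ u ∈ Ugrp p, r = emb p t * u}

/-- `h(l,m) = diag(p^{2m+l}, p^{m+l}, 1, p^m)`. -/
def hmat (l : ℤ) (m : ℕ) : Matrix (Fin 4) (Fin 4) ℚ_[p] :=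
  diagonal ![(p : ℚ_[p]) ^ (2 * (m : ℤ) + l), (p : ℚ_[p]) ^ ((m : ℤ) + l), 1, (p : ℚ_[p]) ^ (m : ℤ)]

/-- `(l,m)`-equivalence: `f ~ g` iff `r·h(l,m)·f·k = h(l,m)·g` for some
`r ∈ R(ℚ_p)`, `k ∈ I_p`. -/
def LMEquiv (l : ℤ) (m : ℕ) (f g : Matrix (Fin 4) (Fin 4) ℚ_[p]) : Prop :=
  ∃ r ∈ Rgrp p a b c, ∃ k ∈ Ip p, r * hmat p l m * f * k = hmat p l m * g

/-- `t₁ = B_{(1,0,0)}^0`. -/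
def t1 : Matrix (Fin 4) (Fin 4) ℚ_[p] := Jmat p * Umat p 1 0 0 * Jmat p * Zmat p 0
/-- `t₂ = B_{(1,0,0)}^∞`. -/
def t2 : Matrix (Fin 4) (Fin 4) ℚ_[p] := Jmat p * Umat p 1 0 0 * Jmat p * Zinf p
/-- `t₃ = B_{(0,0,1)}^0`. -/
def t3 : Matrix (Fin 4) (Fin 4) ℚ_[p] := Jmat p * Umat p 0 0 1 * Jmat p * Zmat p 0
/-- `t₄ = B_{(0,0,1)}^∞`. -/
def t4 : Matrix (Fin 4) (Fin 4) ℚ_[p] := Jmat p * Umat p 0 0 1 * Jmat p * Zinf p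
/-- `t₅ = B_{(0,0,0)}^0`. -/
def t5 : Matrix (Fin 4) (Fin 4) ℚ_[p] := Jmat p * Umat p 0 0 0 * Jmat p * Zmat p 0
/-- `t₆ = B_{(0,0,0)}^∞`. -/
def t6 : Matrix (Fin 4) (Fin 4) ℚ_[p] := Jmat p * Umat p 0 0 0 * Jmat p * Zinf p
/-- `t₇ = A_{(0,0,0)}^0`. -/
def t7 : Matrix (Fin 4) (Fin 4) ℚ_[p] := Umat p 0 0 0 * Jmat p * Zmat p 0
/-- `t₈ = A_{(0,0,0)}^∞`. -/
def t8 : Matrix (Fin 4) (Fin 4) ℚ_[p] := Umat p 0 0 0 * Jmat p * Zinf p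

/-- `T_m`: `{t₁,…,t₈}` if `m > 0`, and `{t₁, t₂, t₅, t₇}` if `m = 0`. -/
def TsetM (m : ℕ) : Set (Matrix (Fin 4) (Fin 4) ℚ_[p]) :=
  if m = 0 then {t1 p, t2 p, t5 p, t7 p}
  else {t1 p, t2 p, t3 p, t4 p, t5 p, t6 p, t7 p, t8 p}

/-- `GL₂(ℤ_p)` viewed inside `GL₂(ℚ_p)`: integral entries and unit determinant. -/
def GL2Z : Set (Matrix (Fin 2) (Fin 2) ℚ_[p]) :=
  {g | (∀ i j, ‖g i j‖ ≤ 1) ∧ ‖g.det‖ = 1}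

/-- The Atkin–Lehner element `η_p`. -/
def etamat : Matrix (Fin 4) (Fin 4) ℚ_[p] :=
  !![0,0,0,1; 0,0,1,0; 0,(p:ℚ_[p]),0,0; (p:ℚ_[p]),0,0,0]

/-- `R_y` for `y ∈ V`: `R_y = (U_{(y,0,0)})ᵀ` for `y ∈ Y` and the given matrix for `y = ∞`. -/
def RV : Option (Fin p) → Matrix (Fin 4) (Fin 4) ℚ_[p]
  | some y => (Umat p (y.val : ℚ_[p]) 0 0)ᵀ
  | none => !![0,0,-1,0; 0,-1,0,0; -1,0,0,0; 0,0,0,1]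

/-- The Weyl element swapping the second and fourth coordinates. -/
def weylTwoFour : Matrix (Fin 4) (Fin 4) ℚ_[p] :=
  !![1,0,0,0; 0,0,0,1; 0,0,1,0; 0,-1,0,0]


lemma mem_Ip_of_entries {k : Matrix (Fin 4) (Fin 4) ℚ_[p]} (μ : ℚ_[p]) (hμ : μ ≠ 0)
    (hk : kᵀ * Jmat p * k = μ • Jmat p) (hdet : ‖k.det‖ = 1) (hint : ∀ i j, ‖k i j‖ ≤ 1)
    (h01 : k 0 1 = 0) (h20 : k 2 0 = 0) (h21 : k 2 1 = 0) (h30 : k 3 0 = 0) (h31 : k 3 1 = 0)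
    (h32 : k 3 2 = 0) : k ∈ Ip p := by
  refine ⟨⟨⟨?_, Units.mk0 μ hμ, hk⟩, hint, hdet⟩, ?_⟩
  · rw [isUnit_iff_ne_zero, ← norm_ne_zero_iff, hdet]
    exact one_ne_zero
  · simp [h01, h20, h21, h30, h31, h32]

lemma one_mem_Ip : (1 : Matrix (Fin 4) (Fin 4) ℚ_[p]) ∈ Ip p := by
  refine mem_Ip_of_entries p 1 one_ne_zero (by simp) (by simp) (fun i j => ?_)
    ?_ ?_ ?_ ?_ ?_ ?_
  all_goals simp [Matrix.one_apply]
  split_ifs <;> simp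

lemma neg_Umat_mem_Ip : -Umat p 0 0 (-1) ∈ Ip p := by
  refine mem_Ip_of_entries p 1 one_ne_zero ?_ ?_ ?_ ?_ ?_ ?_ ?_ ?_ ?_
  · ext i j
    fin_cases i <;> fin_cases j <;>
      simp [Umat, Jmat, Matrix.mul_apply, Fin.sum_univ_four]
  · simp [Umat, Matrix.det_succ_row_zero, Fin.sum_univ_succ]
  · intro i j
    fin_cases i <;> fin_cases j <;> simp [Umat]
  all_goals simp [Umat]

/-- The element of the Levi subgroup with lower triangular upper-left block `(u, 0; e, 1)`. -/
def lowerLevi (u e : ℚ_[p]) : Matrix (Fin 4) (Fin 4) ℚ_[p] :=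
  !![u,0,0,0; e,1,0,0; 0,0,1,-e; 0,0,0,u]

lemma lowerLevi_mem_Ip {u e : ℚ_[p]} (hu : ‖u‖ = 1) (he : ‖e‖ ≤ 1) : lowerLevi p u e ∈ Ip p := by
  have hu0 : u ≠ 0 := by
    rw [← norm_ne_zero_iff, hu]
    exact one_ne_zero
  refine mem_Ip_of_entries p u hu0 ?_ ?_ ?_ ?_ ?_ ?_ ?_ ?_ ?_
  · ext i j
    fin_cases i <;> fin_cases j <;>
      simp [lowerLevi, Jmat, Matrix.mul_apply, Fin.sum_univ_four] <;> ring
  · simp [lowerLevi, Matrix.det_succ_row_zero, Fin.sum_univ_succ, Fin.succAbove, hu]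
  · intro i j
    fin_cases i <;> fin_cases j <;> simp [lowerLevi, hu, he]
  all_goals simp [lowerLevi]

lemma diagonal_mem_Ip {d : Fin 4 → ℚ_[p]} (hd : ∀ i, ‖d i‖ = 1) (hμ : d 0 * d 2 = d 1 * d 3) :
    diagonal d ∈ Ip p := by
  have hd0 : ∀ i, d i ≠ 0 := fun i => by
    rw [← norm_ne_zero_iff, hd]
    exact one_ne_zero
  refine mem_Ip_of_entries p (d 0 * d 2) (mul_ne_zero (hd0 0) (hd0 2)) ?_ ?_ ?_ ?_ ?_ ?_ ?_ ?_ ?_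
  · ext i j
    fin_cases i <;> fin_cases j <;> simp [Jmat, hμ, mul_comm]
  · simp [Matrix.det_diagonal, hd]
  · intro i j
    rcases eq_or_ne i j with rfl | hij
    · simp [hd]
    · simp [hij]
  all_goals simp

lemma Umat_eq_blk (n q r : ℚ_[p]) : Umat p n q r = blk p 1 !![n, q; q, r] 0 1 := by
  ext i j
  fin_cases i <;> fin_cases j <;> rfl

lemma hmat_zero_eq (m : ℕ) : hmat p 0 m =
    diagonal ![((p : ℚ_[p]) ^ m) ^ 2, (p : ℚ_[p]) ^ m, 1, (p : ℚ_[p]) ^ m] := by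
  rw [hmat]
  congr 2
  · rw [← pow_mul, mul_comm m, ← zpow_natCast]
    simp
  · simp

lemma hmat_neg_one_succ_eq (m : ℕ) : hmat p (-1) (m + 1) =
    diagonal ![((p : ℚ_[p]) ^ m) ^ 2 * p, (p : ℚ_[p]) ^ m, 1, (p : ℚ_[p]) ^ m * p] := by
  have h0 : (p : ℚ_[p]) ^ (2 * ((m + 1 : ℕ) : ℤ) + -1) = ((p : ℚ_[p]) ^ m) ^ 2 * p := by
    rw [← pow_mul, mul_comm m, ← pow_succ, ← zpow_natCast]
    congr 1
    push_cast
    ring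
  have h1 : (p : ℚ_[p]) ^ (((m + 1 : ℕ) : ℤ) + -1) = (p : ℚ_[p]) ^ m := by simp
  have h3 : (p : ℚ_[p]) ^ ((m + 1 : ℕ) : ℤ) = (p : ℚ_[p]) ^ m * p := by
    rw [zpow_natCast, pow_succ]
  rw [hmat, h0, h1, h3]

lemma emb_smul_one (z : ℚ_[p]) (hz : z ≠ 0) :
    emb p (z • (1 : Matrix (Fin 2) (Fin 2) ℚ_[p])) = z • 1 := by
  have hinv : (z • (1 : Matrix (Fin 2) (Fin 2) ℚ_[p]))⁻¹ = z⁻¹ • 1 :=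
    Matrix.inv_eq_right_inv (by simp [smul_smul, hz])
  rw [emb, hinv]
  ext i j
  fin_cases i <;> fin_cases j <;>
    simp [blk, finSumFinEquiv, Fin.addCases] <;> field_simp

lemma emb_torus_eq (η : ℚ_[p]) (hD : 1 + b * η + a * c * η ^ 2 ≠ 0) :
    emb p !![1 + b * η, c * η; -a * η, 1] =
      !![1 + b * η, c * η, 0, 0; -a * η, 1, 0, 0; 0, 0, 1, a * η; 0, 0, -c * η, 1 + b * η] := by
  have hdet : (!![1 + b * η, c * η; -a * η, 1] : Matrix (Fin 2) (Fin 2) ℚ_[p]).det =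
      1 + b * η + a * c * η ^ 2 := by
    rw [Matrix.det_fin_two_of]
    ring
  have hadj : (1 + b * η + a * c * η ^ 2) •
      (!![1 + b * η, c * η; -a * η, 1] : Matrix (Fin 2) (Fin 2) ℚ_[p])⁻¹ =
      !![1, -(c * η); a * η, 1 + b * η] := by
    rw [Matrix.inv_def, hdet, Ring.inverse_eq_inv', smul_smul, mul_inv_cancel₀ hD, one_smul,
      Matrix.adjugate_fin_two_of, neg_mul, neg_neg]
  rw [emb, hdet, ← Matrix.transpose_smul, hadj]
  ext i j
  fin_cases i <;> fin_cases j <;> simp [blk, finSumFinEquiv, Fin.addCases]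

lemma torus_mem_Tgrp (η : ℚ_[p]) (hD : 1 + b * η + a * c * η ^ 2 ≠ 0) :
    !![1 + b * η, c * η; -a * η, 1] ∈ Tgrp p a b c := by
  have hdet : (!![1 + b * η, c * η; -a * η, 1] : Matrix (Fin 2) (Fin 2) ℚ_[p]).det =
      1 + b * η + a * c * η ^ 2 := by
    rw [Matrix.det_fin_two_of]
    ring
  refine ⟨by rw [hdet]; exact hD.isUnit, ?_⟩
  rw [hdet]
  ext i j
  fin_cases i <;> fin_cases j <;>
    simp [Smat, Matrix.mul_apply, Fin.sum_univ_two] <;> ring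

lemma torus_eq_smul_add (η : ℚ_[p]) :
    (!![1 + b * η, c * η; -a * η, 1] : Matrix (Fin 2) (Fin 2) ℚ_[p]) =
      (1 + b * η / 2) • (1 : Matrix (Fin 2) (Fin 2) ℚ_[p]) + η • xiS p a b c := by
  ext i j
  fin_cases i <;> fin_cases j <;> simp [xiS] <;> ring

/-- An upper unipotent Levi element close to `1` lies in `T · (lower triangular)`. -/
lemma diagonal_mul_Zmat (Q η y : ℚ_[p]) (hQ : Q ≠ 0) (hη : Q * y = c * η)
    (hD : 1 + b * η + a * c * η ^ 2 ≠ 0) :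
    diagonal ![Q ^ 2, Q, 1, Q] * Zmat p y =
      emb p !![1 + b * η, c * η; -a * η, 1] * blk p 1 0 0 1 * diagonal ![Q ^ 2, Q, 1, Q] *
        lowerLevi p (1 + b * η + a * c * η ^ 2)⁻¹
          (Q * a * η * (1 + b * η + a * c * η ^ 2)⁻¹) := by
  obtain rfl : y = c * η / Q := by rw [← hη]; field_simp
  have hblk : blk p 1 0 0 1 = 1 := by
    simp [blk]
  rw [emb_torus_eq p a b c η hD, hblk, mul_one]
  set D := 1 + b * η + a * c * η ^ 2 with hDdef
  ext i j
  fin_cases i <;> fin_cases j <;>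
    simp [Zmat, lowerLevi, Matrix.mul_apply, Fin.sum_univ_four, Matrix.diagonal_apply,
      Matrix.vecMul_diagonal] <;>
    field_simp <;> ring

lemma norm_torus_det (ha : ‖a‖ = 1) (hb : ‖b‖ ≤ 1) (hc : ‖c‖ = 1) {η : ℚ_[p]} (hη : ‖η‖ < 1) :
    ‖1 + b * η + a * c * η ^ 2‖ = 1 := by
  have hsmall : ‖b * η + a * c * η ^ 2‖ < 1 := by
    refine lt_of_le_of_lt (Padic.nonarchimedean _ _) (max_lt ?_ ?_)
    · rw [norm_mul]
      exact mul_lt_one_of_nonneg_of_lt_one_right hb (norm_nonneg _) hη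
    · rw [norm_mul, norm_mul, ha, hc, norm_pow, one_mul, one_mul]
      exact pow_lt_one₀ (norm_nonneg _) hη two_ne_zero
  rw [add_assoc, Padic.add_eq_max_of_ne (by rw [norm_one]; exact hsmall.ne'), norm_one,
    max_eq_left hsmall.le]

lemma torus_mem_GL2Z (ha : ‖a‖ = 1) (hb : ‖b‖ ≤ 1) (hc : ‖c‖ = 1) {η : ℚ_[p]} (hη : ‖η‖ < 1) :
    !![1 + b * η, c * η; -a * η, 1] ∈ GL2Z p := by
  refine ⟨fun i j => ?_, ?_⟩
  · fin_cases i <;> fin_cases j <;> simp [ha, hc, hη.le]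
    refine (Padic.nonarchimedean _ _).trans (max_le (by simp) ?_)
    rw [norm_mul]
    exact mul_le_one₀ hb (norm_nonneg _) hη.le
  · rw [Matrix.det_fin_two_of, ← norm_torus_det p a b c ha hb hc hη]
    congr 1
    ring

lemma norm_one_add_half_le (hb : ‖b‖ ≤ 1) {z : ℚ_[p]} (hz : ‖z‖ ≤ 1) :
    ‖1 + b * (p * z) / 2‖ ≤ 1 := by
  have hp2 : ‖(p : ℚ_[p]) / 2‖ ≤ 1 := by
    rcases eq_or_ne p 2 with h2 | h2
    · have : (p : ℚ_[p]) = 2 := by exact_mod_cast congrArg (Nat.cast : ℕ → ℚ_[p]) h2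
      rw [this, div_self two_ne_zero, norm_one]
    · have : ‖(2 : ℚ_[p])‖ = 1 := by
        have h := (Padic.norm_natCast_eq_one_iff (p := p) (n := 2)).2
          ((Nat.coprime_primes Fact.out Nat.prime_two).2 h2)
        simpa using h
      rw [norm_div, this, div_one]
      exact Padic.norm_int_le_one (p := p) p
  refine (Padic.nonarchimedean _ _).trans (max_le (by simp) ?_)
  rw [show b * (p * z) / 2 = b * (p / 2) * z by ring, norm_mul, norm_mul]
  exact mul_le_one₀ (mul_le_one₀ hb (norm_nonneg _) hp2) (norm_nonneg _) hz

section Hecke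

variable {p}
variable {B : Matrix (Fin 4) (Fin 4) ℚ_[p] → ℂ}

lemma RV_none_mul_RV_some (y : Fin p) :
    RV p none * RV p (some y) = Umat p (y.val : ℚ_[p]) 0 0 * RV p none := by
  ext i j
  fin_cases i <;> fin_cases j <;>
    simp [RV, Umat, Matrix.mul_apply, Fin.sum_univ_four]

lemma RV_none_mul_self : RV p none * RV p none = 1 := by
  ext i j
  fin_cases i <;> fin_cases j <;>
    simp [RV, Matrix.mul_apply, Fin.sum_univ_four]

lemma Zinf_mul_self : Zinf p * Zinf p = 1 := by
  ext i j
  fin_cases i <;> fin_cases j <;>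
    simp [Zinf, Matrix.mul_apply, Fin.sum_univ_four]

/-- The Hecke relation for the long simple root, along a length-increasing direction. -/
lemma hecke_long (hHR : ∀ g, ∑ v : Option (Fin p), B (g * RV p v) = 0)
    (g : Matrix (Fin 4) (Fin 4) ℚ_[p])
    (hg : ∀ y : Fin p, B (g * (Umat p (y.val : ℚ_[p]) 0 0 * RV p none)) = B (g * RV p none)) :
    (p : ℂ) * B (g * RV p none) = -B g := by
  have h := hHR (g * RV p none)
  rw [Fintype.sum_option] at h
  simp only [mul_assoc, RV_none_mul_self, RV_none_mul_RV_some, hg, mul_one, Finset.sum_const,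
    Finset.card_univ, Fintype.card_fin, nsmul_eq_mul] at h
  linear_combination h

/-- The Hecke relation for the short simple root, along a length-increasing direction. -/
lemma hecke_short (hHZ : ∀ g, ∑ v : Option (Fin p), B (g * ZV p v) = 0)
    (g : Matrix (Fin 4) (Fin 4) ℚ_[p])
    (hg : ∀ y : Fin p, B (g * (Zinf p * Zmat p (y.val : ℚ_[p]))) = B (g * Zinf p)) :
    (p : ℂ) * B (g * Zinf p) = -B g := by
  have h := hHZ (g * Zinf p)
  rw [Fintype.sum_option] at h
  simp only [ZV, mul_assoc, Zinf_mul_self, hg, mul_one, Finset.sum_const,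
    Finset.card_univ, Fintype.card_fin, nsmul_eq_mul] at h
  linear_combination h

lemma diagonal_mul_Umat (e₀ e₁ e₂ e₃ n q r n' q' r' : ℚ_[p]) (hn : e₀ * n = n' * e₂)
    (hq : e₀ * q = q' * e₃) (hq' : e₁ * q = q' * e₂) (hr : e₁ * r = r' * e₃) :
    diagonal ![e₀, e₁, e₂, e₃] * Umat p n q r = Umat p n' q' r' * diagonal ![e₀, e₁, e₂, e₃] := by
  ext i j
  fin_cases i <;> fin_cases j <;>
    simp [Umat, Matrix.mul_apply, Matrix.diagonal_apply, hn, hq, hq', hr]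

lemma RV_none_mul_Zinf_mul_Zmat (y : ℚ_[p]) :
    RV p none * (Zinf p * Zmat p y) = Umat p 0 y 0 * (RV p none * Zinf p) := by
  ext i j
  fin_cases i <;> fin_cases j <;>
    simp [RV, Zinf, Zmat, Umat, Matrix.mul_apply, Fin.sum_univ_four]

lemma weylTwoFour_mul_Umat (n : ℚ_[p]) :
    weylTwoFour p * Umat p n 0 0 = Umat p n 0 0 * weylTwoFour p := by
  ext i j
  fin_cases i <;> fin_cases j <;>
    simp [weylTwoFour, Umat, Matrix.mul_apply, Fin.sum_univ_four]

lemma t3_eq : t3 p = Umat p 0 0 (-1) * weylTwoFour p * -Umat p 0 0 (-1) := by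
  ext i j
  fin_cases i <;> fin_cases j <;>
    simp [t3, Jmat, Zmat, weylTwoFour, Umat, Matrix.mul_apply, Fin.sum_univ_four]

lemma diagonal_weylTwoFour_etamat (Q : ℚ_[p]) :
    diagonal ![Q ^ 2 * p, Q, 1, Q * p] * weylTwoFour p * etamat p =
      (p : ℚ_[p]) • (diagonal ![Q ^ 2, Q, 1, Q] * (RV p none * Zinf p) *
        diagonal ![-1, -1, -1, -1]) := by
  ext i j
  fin_cases i <;> fin_cases j <;>
    simp [RV, Zinf, etamat, weylTwoFour, Matrix.mul_apply, Fin.sum_univ_four,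
      Matrix.diagonal_apply] <;> ring

lemma diagonal_Zinf_etamat (Q : ℚ_[p]) :
    diagonal ![(Q * p) ^ 2, Q * p, 1, Q * p] * Zinf p * etamat p =
      (p : ℚ_[p]) • (diagonal ![Q ^ 2 * p, Q, 1, Q * p] * (weylTwoFour p * RV p none) *
        diagonal ![-1, 1, -1, 1]) := by
  ext i j
  fin_cases i <;> fin_cases j <;>
    simp [RV, Zinf, etamat, weylTwoFour, Matrix.mul_apply, Fin.sum_univ_four,
      Matrix.diagonal_apply] <;> ring

end Hecke

theorem bessel_value_at_minus_one
    (ha : ‖a‖ = 1) (hb : ‖b‖ ≤ 1) (hc : ‖c‖ = 1)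
    (hd : ‖b ^ 2 - 4 * a * c‖ = 1)
    (hnsq : ∀ z : ℚ_[p], z ^ 2 ≠ b ^ 2 - 4 * a * c)
    (B : Matrix (Fin 4) (Fin 4) ℚ_[p] → ℂ) (ψ : ℚ_[p] → ℂ)
    (Λ : Matrix (Fin 2) (Fin 2) ℚ_[p] → ℂ)
    (hψadd : ∀ x y : ℚ_[p], ψ (x + y) = ψ x * ψ y)
    (hψtriv : ∀ x : ℚ_[p], ‖x‖ ≤ 1 → ψ x = 1)
    (hψnontriv : ∃ x : ℚ_[p], ‖x‖ ≤ p ∧ ψ x ≠ 1)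
    (hΛmul : ∀ s t, s ∈ Tgrp p a b c → t ∈ Tgrp p a b c → Λ (s * t) = Λ s * Λ t)
    (hΛne : ∀ t ∈ Tgrp p a b c, Λ t ≠ 0)
    (hΛscalar : ∀ z : ℚ_[p], z ≠ 0 → Λ (z • (1 : Matrix (Fin 2) (Fin 2) ℚ_[p])) = 1)
    (hΛtriv : ∀ x y : ℚ_[p], ‖x‖ ≤ 1 → ‖y‖ < 1 →
      (x • (1 : Matrix (Fin 2) (Fin 2) ℚ_[p]) + y • xiS p a b c) ∈ GL2Z p →
      Λ (x • (1 : Matrix (Fin 2) (Fin 2) ℚ_[p]) + y • xiS p a b c) = 1)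
    (hBessel : ∀ t ∈ Tgrp p a b c, ∀ X : Matrix (Fin 2) (Fin 2) ℚ_[p], Xᵀ = X →
      ∀ g : Matrix (Fin 4) (Fin 4) ℚ_[p], ∀ k ∈ Ip p,
      B (emb p t * blk p 1 X 0 1 * g * k) = Λ t * ψ ((Smat p a b c * X).trace) * B g)
    (hB1 : B 1 = 1) (w : ℂ) (hw : w = 1 ∨ w = -1)
    (hHZ : ∀ g : Matrix (Fin 4) (Fin 4) ℚ_[p], ∑ v : Option (Fin p), B (g * ZV p v) = 0)
    (hHeta : ∀ g : Matrix (Fin 4) (Fin 4) ℚ_[p], B (g * etamat p) = w * B g)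
    (hHR : ∀ g : Matrix (Fin 4) (Fin 4) ℚ_[p], ∑ v : Option (Fin p), B (g * RV p v) = 0) :
    ∀ m : ℕ, 1 ≤ m →
      B (hmat p (-1) m * t3 p) =
        w * ψ (-c / (p : ℚ_[p])) * (p : ℂ) ^ (2 - 4 * (m : ℤ)) := by
  have hT1 : ∀ z : ℚ_[p], z ≠ 0 → z • (1 : Matrix (Fin 2) (Fin 2) ℚ_[p]) ∈ Tgrp p a b c := by
    refine fun z hz => ⟨?_, ?_⟩
    · simp [hz]
    · ext i j
      simp
      ring
  have hequiv : ∀ z : ℚ_[p], z ≠ 0 → ∀ n q r : ℚ_[p], ∀ g, ∀ k ∈ Ip p,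
      B (z • (Umat p n q r * g * k)) = ψ (a * n + b * q + c * r) * B g := by
    intro z hz n q r g k hk
    have hX : (!![n, q; q, r] : Matrix (Fin 2) (Fin 2) ℚ_[p])ᵀ = !![n, q; q, r] := by
      ext i j
      fin_cases i <;> fin_cases j <;> rfl
    have h := hBessel _ (hT1 z hz) _ hX g k hk
    rw [emb_smul_one p z hz, hΛscalar z hz, one_mul, ← Umat_eq_blk] at h
    rw [← show (z • 1 : Matrix (Fin 4) (Fin 4) ℚ_[p]) * Umat p n q r * g * k =
      z • (Umat p n q r * g * k) by simp [mul_assoc], h]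
    congr 2
    simp [Smat, Matrix.trace_fin_two]
    ring
  have hU0 : Umat p 0 0 0 = 1 := by
    ext i j
    fin_cases i <;> fin_cases j <;> rfl
  have hψ0 : ψ 0 = 1 := hψtriv 0 (by simp)
  have hscale : ∀ g, ∀ k ∈ Ip p, B ((p : ℚ_[p]) • (g * k)) = B g := by
    intro g k hk
    have h := hequiv p (by exact_mod_cast (Fact.out : p.Prime).ne_zero) 0 0 0 g k hk
    simpa [hU0, hψ0] using h
  have hUB : ∀ n q r : ℚ_[p], ∀ g, B (Umat p n q r * g) = ψ (a * n + b * q + c * r) * B g := by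
    intro n q r g
    simpa using hequiv 1 one_ne_zero n q r g 1 (one_mem_Ip p)
  have hRB : ∀ g, ∀ k ∈ Ip p, B (g * k) = B g := by
    intro g k hk
    simpa [hU0, hψ0] using hequiv 1 one_ne_zero 0 0 0 g k hk
  have hww : w * w = 1 := by
    rcases hw with rfl | rfl <;> norm_num
  have hp0 : (p : ℂ) ≠ 0 := by exact_mod_cast (Fact.out : p.Prime).ne_zero
  have hpQ0 : (p : ℚ_[p]) ≠ 0 := by exact_mod_cast (Fact.out : p.Prime).ne_zero
  have hnat : ∀ n : ℕ, ‖(n : ℚ_[p])‖ ≤ 1 := fun n => Padic.norm_int_le_one (p := p) n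
  have hψn : ∀ n : ℕ, ψ (a * n) = 1 := fun n => hψtriv _ (by
    rw [norm_mul, ha, one_mul]
    exact hnat n)
  have hψq : ∀ n : ℕ, ψ (b * n) = 1 := fun n => hψtriv _ (by
    rw [norm_mul]
    exact mul_le_one₀ hb (norm_nonneg _) (hnat n))
  have hlong : ∀ m : ℕ, (p : ℂ) * B (hmat p 0 m * RV p none) = -B (hmat p 0 m) := by
    refine fun m => hecke_long hHR _ fun y => ?_
    rw [← mul_assoc, hmat_zero_eq,
      diagonal_mul_Umat _ _ _ _ _ _ _ (((p ^ m) ^ 2 * y.val : ℕ) : ℚ_[p]) 0 0 (by simp) (by simp)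
        (by simp) (by simp), mul_assoc, hUB]
    simp only [mul_zero, add_zero, hψn, one_mul]
  have hshort : ∀ m : ℕ, (p : ℂ) * B (hmat p 0 m * RV p none * Zinf p) =
      -B (hmat p 0 m * RV p none) := by
    refine fun m => hecke_short hHZ _ fun y => ?_
    rw [mul_assoc, RV_none_mul_Zinf_mul_Zmat, ← mul_assoc, hmat_zero_eq,
      diagonal_mul_Umat _ _ _ _ _ _ _ 0 ((p ^ m * y.val : ℕ) : ℚ_[p]) 0 (by simp)
        (by push_cast; ring) (by simp) (by simp), mul_assoc, hUB, mul_assoc]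
    simp only [mul_zero, add_zero, zero_add, hψq, one_mul]
  have hlong' : ∀ m : ℕ, (p : ℂ) * B (hmat p (-1) (m + 1) * weylTwoFour p * RV p none) =
      -B (hmat p (-1) (m + 1) * weylTwoFour p) := by
    refine fun m => hecke_long hHR _ fun y => ?_
    rw [← mul_assoc, mul_assoc _ (weylTwoFour p), weylTwoFour_mul_Umat, ← mul_assoc,
      hmat_neg_one_succ_eq,
      diagonal_mul_Umat _ _ _ _ _ _ _ (((p ^ m) ^ 2 * p * y.val : ℕ) : ℚ_[p]) 0 0 (by simp)
        (by simp) (by simp) (by simp), mul_assoc, mul_assoc, hUB, ← mul_assoc]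
    simp only [mul_zero, add_zero, hψn, one_mul]
  have hdiag₁ : diagonal ![-1, -1, -1, -1] ∈ Ip p :=
    diagonal_mem_Ip p (fun i => by fin_cases i <;> simp) (by simp)
  have hdiag₂ : diagonal ![-1, 1, -1, 1] ∈ Ip p :=
    diagonal_mem_Ip p (fun i => by fin_cases i <;> simp) (by simp)
  have heta₁ : ∀ m : ℕ, B (hmat p 0 m * RV p none * Zinf p) =
      w * B (hmat p (-1) (m + 1) * weylTwoFour p) := by
    intro m
    rw [← hHeta, hmat_neg_one_succ_eq, diagonal_weylTwoFour_etamat, hscale _ _ hdiag₁,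
      hmat_zero_eq, mul_assoc]
  have heta₂ : ∀ m : ℕ, B (hmat p (-1) (m + 1) * weylTwoFour p * RV p none) =
      w * B (hmat p 0 (m + 1) * Zinf p) := by
    intro m
    rw [← hHeta, hmat_zero_eq, pow_succ (p : ℚ_[p]), diagonal_Zinf_etamat, hscale _ _ hdiag₂,
      hmat_neg_one_succ_eq, mul_assoc]
  have htorus : ∀ m : ℕ, B (hmat p 0 (m + 1) * Zinf p) = -p * B (hmat p 0 (m + 1)) := by
    intro m
    have hy : ∀ y : Fin p, B (hmat p 0 (m + 1) * Zmat p (y.val : ℚ_[p])) =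
        B (hmat p 0 (m + 1)) := by
      intro y
      have hz : ‖(p : ℚ_[p]) ^ m * y.val / c‖ ≤ 1 := by
        rw [norm_div, hc, div_one]
        exact_mod_cast hnat (p ^ m * y.val)
      have hη : ‖(p : ℚ_[p]) * ((p : ℚ_[p]) ^ m * y.val / c)‖ < 1 := by
        rw [norm_mul]
        exact mul_lt_one_of_nonneg_of_lt_one_left (norm_nonneg _) Padic.norm_p_lt_one hz
      have hz' := norm_one_add_half_le p b hb hz
      set η := (p : ℚ_[p]) * ((p : ℚ_[p]) ^ m * y.val / c) with hηdef
      have hc0 : c ≠ 0 := by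
        rw [← norm_ne_zero_iff, hc]
        exact one_ne_zero
      have hDn := norm_torus_det p a b c ha hb hc hη
      have hD : 1 + b * η + a * c * η ^ 2 ≠ 0 := by
        rw [← norm_ne_zero_iff, hDn]
        exact one_ne_zero
      have hΛ : Λ !![1 + b * η, c * η; -a * η, 1] = 1 := by
        have hGL := torus_mem_GL2Z p a b c ha hb hc hη
        rw [torus_eq_smul_add] at hGL ⊢
        exact hΛtriv _ _ hz' hη hGL
      rw [hmat_zero_eq, diagonal_mul_Zmat p a b c _ η _ (pow_ne_zero _ hpQ0) (by
          rw [hηdef]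
          field_simp
          ring) hD,
        hBessel _ (torus_mem_Tgrp p a b c η hD) 0 (by simp) _ _ (lowerLevi_mem_Ip p
          (by rw [norm_inv, hDn, inv_one]) ?_), hΛ]
      · simp [hψ0]
      · rw [norm_mul, norm_mul, norm_mul, norm_inv, hDn, ha, inv_one, mul_one, mul_one]
        exact mul_le_one₀ (by exact_mod_cast hnat (p ^ (m + 1))) (norm_nonneg _) hη.le
    have h := hHZ (hmat p 0 (m + 1))
    rw [Fintype.sum_option] at h
    simp only [ZV, hy, Finset.sum_const, Finset.card_univ, Fintype.card_fin, nsmul_eq_mul] at h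
    linear_combination h
  have hrefl : ∀ m : ℕ, (p : ℂ) ^ 2 * B (hmat p (-1) (m + 1) * weylTwoFour p) =
      w * B (hmat p 0 m) := by
    intro m
    linear_combination (-(p : ℂ) ^ 2 * B (hmat p (-1) (m + 1) * weylTwoFour p)) * hww
      - w * p ^ 2 * heta₁ m + w * p * hshort m - w * hlong m
  have hstep : ∀ m : ℕ, (p : ℂ) ^ 4 * B (hmat p 0 (m + 1)) = B (hmat p 0 m) := by
    intro m
    linear_combination (B (hmat p 0 m) - (p : ℂ) ^ 4 * B (hmat p 0 (m + 1))) * hww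
      + w * hrefl m - w * p ^ 2 * hlong' m + w * p ^ 3 * heta₂ m + w * w * p ^ 3 * htorus m
  have hvalue : ∀ m : ℕ, (p : ℂ) ^ (4 * m) * B (hmat p 0 m) = 1 := by
    intro m
    induction m with
    | zero =>
      have h1 : hmat p 0 0 = 1 := by
        rw [hmat_zero_eq]
        ext i j
        fin_cases i <;> fin_cases j <;> simp
      rw [h1, hB1]
      simp
    | succ m ih =>
      rw [← ih, ← hstep m]
      ring
  rintro (_ | m) hm
  · omega
  rw [t3_eq, ← mul_assoc, hRB _ _ (neg_Umat_mem_Ip p), ← mul_assoc]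
  nth_rewrite 1 [hmat_neg_one_succ_eq]
  rw [diagonal_mul_Umat _ _ _ _ _ _ _ 0 0 (-(1 / p)) (by simp) (by simp) (by simp)
    (by field_simp), ← hmat_neg_one_succ_eq, mul_assoc, hUB,
    show a * 0 + b * 0 + c * -(1 / (p : ℚ_[p])) = -c / p by ring]
  have hpow : (p : ℂ) ^ (2 - 4 * ((m + 1 : ℕ) : ℤ)) = ((p : ℂ) ^ (4 * m + 2))⁻¹ := by
    rw [← zpow_natCast, ← _root_.zpow_neg]
    congr 1
  have hval : B (hmat p (-1) (m + 1) * weylTwoFour p) = w * ((p : ℂ) ^ (4 * m + 2))⁻¹ := by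
    rw [eq_mul_inv_iff_mul_eq₀ (pow_ne_zero _ hp0)]
    linear_combination (p : ℂ) ^ (4 * m) * hrefl m + w * hvalue m
  rw [hpow, hval]
  ring
end
end

section
/- Let Ũ_p be the subgroup of K̃ consisting of elements whose reduction modulo the maximal ideal m_L has zero entries at positions (1,2), (3,2), (4,1), (4,2), (4,3). Then for every l ∈ ℤ: if m > 0, the element Θ·h(l,m)·t_i lies in P·Ũ_p for i ∈ {1, 3, 5, 7} and does not lie in P·Ũ_p for i ∈ {2, 4, 6, 8}; if m = 0, the element Θ·h(l,0)·t_i lies in P·Ũ_p for i ∈ {1, 5} and does not lie in P·Ũ_p for i ∈ {2, 7}. -/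
open Matrix

noncomputable section

variable (p : ℕ) [Fact p.Prime]

variable (L : Type) [NormedField L] [Algebra ℚ_[p] L]

/-- The 4×4 matrix `J` over `L`. -/
def JmatL : Matrix (Fin 4) (Fin 4) L :=
  !![0,0,1,0; 0,0,0,1; -1,0,0,0; 0,-1,0,0]

/-- The unitary similitude group `G̃ = GU(2,2;L)` (with conjugation `σ`). -/
def GU (σ : L ≃+* L) : Set (Matrix (Fin 4) (Fin 4) L) :=
  {g | ∃ μ : ℚ_[p], μ ≠ 0 ∧
    (g.map σ)ᵀ * JmatL L * g = algebraMap ℚ_[p] L μ • JmatL L}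

/-- `K̃ = G̃ ∩ GL₄(O_L)`. -/
def Ktilde (σ : L ≃+* L) : Set (Matrix (Fin 4) (Fin 4) L) :=
  {g | g ∈ GU p L σ ∧ (∀ i j, ‖g i j‖ ≤ 1) ∧ ‖g.det‖ = 1}

/-- The parabolic subgroup `P` of `G̃`: vanishing (2,1), (3,1), (4,1) entries. -/
def Ptilde (σ : L ≃+* L) : Set (Matrix (Fin 4) (Fin 4) L) :=
  {g | g ∈ GU p L σ ∧ g 1 0 = 0 ∧ g 2 0 = 0 ∧ g 3 0 = 0}

/-- The element `Θ`, built from `α = (b + √−d)/(2c)`. -/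
def Theta (σ : L ≃+* L) (sqd : L) (b c : ℚ_[p]) : Matrix (Fin 4) (Fin 4) L :=
  !![1,0,0,0;
     (algebraMap ℚ_[p] L b + sqd) / (2 * algebraMap ℚ_[p] L c),1,0,0;
     0,0,1,-σ ((algebraMap ℚ_[p] L b + sqd) / (2 * algebraMap ℚ_[p] L c));
     0,0,0,1]

/-- Base change of a matrix from `ℚ_p` to `L`. -/
def mapL (g : Matrix (Fin 4) (Fin 4) ℚ_[p]) : Matrix (Fin 4) (Fin 4) L :=
  g.map (algebraMap ℚ_[p] L)

/-- The subgroup `Ũ_p` of `K̃`: reduction mod `m_L` has zero entries at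
positions (1,2), (3,2), (4,1), (4,2), (4,3). -/
def Utilde (σ : L ≃+* L) : Set (Matrix (Fin 4) (Fin 4) L) :=
  {g | g ∈ Ktilde p L σ ∧ ‖g 0 1‖ < 1 ∧ ‖g 2 1‖ < 1 ∧
    ‖g 3 0‖ < 1 ∧ ‖g 3 1‖ < 1 ∧ ‖g 3 2‖ < 1}

/-- The set `P·Ũ_p`. -/
def PUtilde (σ : L ≃+* L) : Set (Matrix (Fin 4) (Fin 4) L) :=
  {x | ∃ q ∈ Ptilde p L σ, ∃ u ∈ Utilde p L σ, x = q * u}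

section Helpers

variable {p L}

lemma mapL_mul (g k : Matrix (Fin 4) (Fin 4) ℚ_[p]) :
    mapL p L (g * k) = mapL p L g * mapL p L k := Matrix.map_mul

/-- The conjugate `h⁻¹ Θ h`, with `β = p ^ m * α` and `β' = σ β`. -/
def shear (β β' : L) : Matrix (Fin 4) (Fin 4) L :=
  !![1,0,0,0; β,1,0,0; 0,0,1,-β'; 0,0,0,1]

lemma Theta_mul_hmat (σ : L ≃+* L) (sqd : L) (b c : ℚ_[p]) (l : ℤ) (m : ℕ)
    (β : L) (hβ : β = (p : L) ^ m *
      ((algebraMap ℚ_[p] L b + sqd) / (2 * algebraMap ℚ_[p] L c))) :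
    Theta p L σ sqd b c * mapL p L (hmat p l m) =
      mapL p L (hmat p l m) * shear β (σ β) := by
  have hp : (p : ℚ_[p]) ≠ 0 := by exact_mod_cast (Fact.out : p.Prime).ne_zero
  have hp' : (p : L) ≠ 0 := by
    simpa using (map_ne_zero (algebraMap ℚ_[p] L)).2 hp
  subst hβ
  ext i j
  fin_cases i <;> fin_cases j <;>
    simp [Theta, mapL, hmat, shear, Matrix.mul_apply, Fin.sum_univ_four, zpow_add₀ hp', two_mul,
      map_zpow₀] <;> ring

lemma hmat_mem_GU (σ : L ≃+* L) (l : ℤ) (m : ℕ)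
    {q : Matrix (Fin 4) (Fin 4) L} (hq : (q.map σ)ᵀ * JmatL L * q = JmatL L) :
    mapL p L (hmat p l m) * q ∈ GU p L σ := by
  have hp : (p : ℚ_[p]) ≠ 0 := by exact_mod_cast (Fact.out : p.Prime).ne_zero
  have hp' : (p : L) ≠ 0 := by
    simpa using (map_ne_zero (algebraMap ℚ_[p] L)).2 hp
  have hh : ((mapL p L (hmat p l m)).map σ)ᵀ * JmatL L * mapL p L (hmat p l m) =
      algebraMap ℚ_[p] L ((p : ℚ_[p]) ^ (2 * (m : ℤ) + l)) • JmatL L := by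
    ext i j
    fin_cases i <;> fin_cases j <;>
      simp [mapL, hmat, JmatL, Matrix.mul_apply, Fin.sum_univ_four, zpow_add₀ hp', two_mul,
        map_zpow₀] <;> ring
  refine ⟨(p : ℚ_[p]) ^ (2 * (m : ℤ) + l), zpow_ne_zero _ hp, ?_⟩
  calc ((mapL p L (hmat p l m) * q).map σ)ᵀ * JmatL L * (mapL p L (hmat p l m) * q)
      = (q.map σ)ᵀ * (((mapL p L (hmat p l m)).map σ)ᵀ * JmatL L * mapL p L (hmat p l m)) * q := by
        have : (mapL p L (hmat p l m) * q).map σ =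
          (mapL p L (hmat p l m)).map σ * q.map σ := Matrix.map_mul
        rw [this, transpose_mul]
        simp only [Matrix.mul_assoc]
    _ = _ := by rw [hh, Matrix.mul_smul, Matrix.smul_mul, hq]

/-- An element of `P·Ũ_p` obtained from a factorization `g = q u` with `q` unitary. -/
lemma mem_PUtilde_of_eq (σ : L ≃+* L) (l : ℤ) (m : ℕ)
    {g q u : Matrix (Fin 4) (Fin 4) L} (hq : (q.map σ)ᵀ * JmatL L * q = JmatL L)
    (hq1 : q 1 0 = 0) (hq2 : q 2 0 = 0) (hq3 : q 3 0 = 0)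
    (hu : u ∈ Utilde p L σ) (hg : g = q * u) :
    mapL p L (hmat p l m) * g ∈ PUtilde p L σ := by
  refine ⟨mapL p L (hmat p l m) * q, ⟨hmat_mem_GU σ l m hq, ?_, ?_, ?_⟩, u, hu, ?_⟩
  · simp [mapL, hmat, hq1]
  · simp [mapL, hmat, hq2]
  · simp [mapL, hmat, hq3]
  · rw [hg, Matrix.mul_assoc]

lemma mem_Utilde (σ : L ≃+* L) {u : Matrix (Fin 4) (Fin 4) L}
    (hJ : (u.map σ)ᵀ * JmatL L * u = JmatL L) (hint : ∀ i j, ‖u i j‖ ≤ 1) (hdet : ‖u.det‖ = 1)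
    (h01 : ‖u 0 1‖ < 1) (h21 : ‖u 2 1‖ < 1) (h30 : ‖u 3 0‖ < 1) (h31 : ‖u 3 1‖ < 1)
    (h32 : ‖u 3 2‖ < 1) : u ∈ Utilde p L σ :=
  ⟨⟨⟨1, one_ne_zero, by simpa using hJ⟩, hint, hdet⟩, h01, h21, h30, h31, h32⟩

lemma norm_det_lt_one [IsUltrametricDist L] {u : Matrix (Fin 4) (Fin 4) L}
    (hint : ∀ i j, ‖u i j‖ ≤ 1) (h2 : ∀ j, j ≠ 3 → ‖u 2 j‖ < 1)
    (h3 : ∀ j, j ≠ 3 → ‖u 3 j‖ < 1) : ‖u.det‖ < 1 := by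
  have prod_lt : ∀ (f : Fin 4 → ℝ) (i : Fin 4), (∀ k, 0 ≤ f k) → (∀ k, f k ≤ 1) → f i < 1 →
      ∏ k, f k < 1 := by
    intro f i h0 h1 hi
    rw [← Finset.mul_prod_erase _ _ (Finset.mem_univ i)]
    exact mul_lt_one_of_nonneg_of_lt_one_left (h0 i) hi
      (Finset.prod_le_one (fun k _ => h0 k) (fun k _ => h1 k))
  obtain ⟨τ, -, hτ⟩ := IsUltrametricDist.exists_norm_finsetSum_le_of_nonempty
    (Finset.univ_nonempty (α := Equiv.Perm (Fin 4)))
    (fun τ => (Equiv.Perm.sign τ : ℤ) • ∏ i, uᵀ (τ i) i)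
  rw [← det_transpose, det_apply]
  refine hτ.trans_lt ?_
  have hsign : ‖((Equiv.Perm.sign τ : ℤˣ) : ℤ) • ∏ i, uᵀ (τ i) i‖ = ∏ i, ‖u i (τ i)‖ := by
    rcases Int.units_eq_one_or (Equiv.Perm.sign τ) with h | h <;> simp [h, norm_prod]
  rw [hsign]
  by_cases hj : τ 2 = 3
  · refine prod_lt _ 3 (fun k => norm_nonneg _) (fun k => hint _ _) (h3 _ fun h => ?_)
    exact absurd (τ.injective (hj.trans h.symm)) (by decide)
  · exact prod_lt _ 2 (fun k => norm_nonneg _) (fun k => hint _ _) (h2 _ hj)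

/-- The third row of an element of `P·Ũ_p` is dominated by its first and third entries, strictly
so at the second entry. -/
lemma row_bound_of_mem_PUtilde [IsUltrametricDist L] (σ : L ≃+* L)
    {x : Matrix (Fin 4) (Fin 4) L} (hx : x ∈ PUtilde p L σ) :
    ‖x 2 1‖ < max ‖x 2 0‖ ‖x 2 2‖ ∧ ‖x 2 3‖ ≤ max ‖x 2 0‖ ‖x 2 2‖ := by
  obtain ⟨q, ⟨⟨μ, hμ, hq⟩, h1, h2, h3⟩, u, ⟨⟨-, hint, hdet⟩, -, h21, h30, h31, h32⟩, rfl⟩ := hx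
  have hμ' : algebraMap ℚ_[p] L μ ≠ 0 := (map_ne_zero _).2 hμ
  have row (j : Fin 4) : σ (q 0 0) * q 2 j = algebraMap ℚ_[p] L μ * JmatL L 0 j := by
    have := congrFun (congrFun hq 0) j
    simpa [Matrix.mul_apply, Fin.sum_univ_four, JmatL, h1, h2, h3] using this
  have hne : σ (q 0 0) * q 2 2 ≠ 0 := by rw [row]; simpa [JmatL] using hμ
  have hq00 := left_ne_zero_of_mul hne
  have hq22 := right_ne_zero_of_mul hne
  have z1 : q 2 1 = 0 := (mul_eq_zero.1 ((row 1).trans (by simp [JmatL]))).resolve_left hq00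
  have z3 : q 2 3 = 0 := (mul_eq_zero.1 ((row 3).trans (by simp [JmatL]))).resolve_left hq00
  have hrow (j : Fin 4) : ‖(q * u) 2 j‖ = ‖q 2 2‖ * ‖u 2 j‖ := by
    simp [Matrix.mul_apply, Fin.sum_univ_four, h2, z1, z3]
  have hmax : 1 ≤ max ‖u 2 0‖ ‖u 2 2‖ := by
    by_contra! h
    obtain ⟨h20, h22⟩ := max_lt_iff.1 h
    refine (norm_det_lt_one hint (fun j hj => ?_) fun j hj => ?_).ne hdet
    · fin_cases j <;> first | assumption | exact absurd rfl hj
    · fin_cases j <;> first | assumption | exact absurd rfl hj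
  simp only [hrow, ← mul_max_of_nonneg _ _ (norm_nonneg (q 2 2))]
  have hpos := norm_pos_iff.2 hq22
  exact ⟨mul_lt_mul_of_pos_left (h21.trans_le hmax) hpos,
    mul_le_mul_of_nonneg_left ((hint 2 3).trans hmax) hpos.le⟩

lemma third_row (l : ℤ) (m : ℕ) (β β' : L) (t : Matrix (Fin 4) (Fin 4) L)
    (j : Fin 4) : (mapL p L (hmat p l m) * (shear β β' * t)) 2 j = t 2 j - β' * t 3 j := by
  have h (M : Matrix (Fin 4) (Fin 4) L) : (mapL p L (hmat p l m) * M) 2 j = M 2 j := by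
    simp [mapL, hmat, Matrix.mul_apply, Matrix.diagonal_apply]
  rw [h]
  simp only [Matrix.mul_apply, Fin.sum_univ_four]
  simp [shear, sub_eq_add_neg]

lemma mapL_t1 : mapL p L (t1 p) =
    !![-1,0,0,0; 0,-1,0,0; 1,0,-1,0; 0,0,0,-1] := by
  ext i j
  fin_cases i <;> fin_cases j <;>
    simp [t1, mapL, Jmat, Umat, Zmat]

lemma mapL_t2 : mapL p L (t2 p) =
    !![0,-1,0,0; -1,0,0,0; 0,1,0,-1; 0,0,-1,0] := by
  ext i j
  fin_cases i <;> fin_cases j <;>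
    simp [t2, mapL, Jmat, Umat, Zinf]

lemma mapL_t3 : mapL p L (t3 p) =
    !![-1,0,0,0; 0,-1,0,0; 0,0,-1,0; 0,1,0,-1] := by
  ext i j
  fin_cases i <;> fin_cases j <;>
    simp [t3, mapL, Jmat, Umat, Zmat]

lemma mapL_t4 : mapL p L (t4 p) =
    !![0,-1,0,0; -1,0,0,0; 0,0,0,-1; 1,0,-1,0] := by
  ext i j
  fin_cases i <;> fin_cases j <;>
    simp [t4, mapL, Jmat, Umat, Zinf]

lemma mapL_t5 : mapL p L (t5 p) =
    !![-1,0,0,0; 0,-1,0,0; 0,0,-1,0; 0,0,0,-1] := by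
  ext i j
  fin_cases i <;> fin_cases j <;>
    simp [t5, mapL, Jmat, Umat, Zmat]

lemma mapL_t6 : mapL p L (t6 p) =
    !![0,-1,0,0; -1,0,0,0; 0,0,0,-1; 0,0,-1,0] := by
  ext i j
  fin_cases i <;> fin_cases j <;>
    simp [t6, mapL, Jmat, Umat, Zinf]

lemma mapL_t7 : mapL p L (t7 p) =
    !![0,0,1,0; 0,0,0,1; -1,0,0,0; 0,-1,0,0] := by
  ext i j
  fin_cases i <;> fin_cases j <;>
    simp [t7, mapL, Jmat, Umat, Zmat]

lemma mapL_t8 : mapL p L (t8 p) =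
    !![0,0,0,1; 0,0,1,0; 0,-1,0,0; -1,0,0,0] := by
  ext i j
  fin_cases i <;> fin_cases j <;>
    simp [t8, mapL, Jmat, Umat, Zinf]

lemma h_mul_shear_mul_t1_mem (σ : L ≃+* L) (l : ℤ) (m : ℕ) (β : L)
    (hinv : ∀ x, σ (σ x) = x) (hσnorm : ∀ x, ‖σ x‖ = ‖x‖) (hβ : ‖β‖ ≤ 1) :
    mapL p L (hmat p l m) * (shear β (σ β) * mapL p L (t1 p)) ∈ PUtilde p L σ := by
  refine mem_PUtilde_of_eq σ l m (q := 1)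
    (u := !![-1,0,0,0; -β,-1,0,0; 1,0,-1,σ β; 0,0,0,-1]) ?_ ?_ ?_ ?_ (mem_Utilde σ ?_ ?_ ?_ ?_ ?_ ?_ ?_ ?_) ?_
  case refine_1 =>
    simp
  case refine_5 =>
    ext i j
    fin_cases i <;> fin_cases j <;> simp [JmatL, Matrix.mul_apply, Fin.sum_univ_four, hinv]
  case refine_6 =>
    intro i j
    fin_cases i <;> fin_cases j <;> simp [hσnorm, hβ]
  case refine_7 => simp [Matrix.det_succ_row_zero, Fin.sum_univ_succ, Fin.succAbove]
  case refine_13 =>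
    rw [mapL_t1]
    ext i j
    fin_cases i <;> fin_cases j <;> simp [shear, Matrix.mul_apply, Fin.sum_univ_four]
  all_goals simp

lemma h_mul_shear_mul_t3_mem (σ : L ≃+* L) (l : ℤ) (m : ℕ) (β : L)
    (hinv : ∀ x, σ (σ x) = x) (hσnorm : ∀ x, ‖σ x‖ = ‖x‖) (hβ : ‖β‖ < 1) :
    mapL p L (hmat p l m) * (shear β (σ β) * mapL p L (t3 p)) ∈ PUtilde p L σ := by
  refine mem_PUtilde_of_eq σ l m (q := !![-1,0,0,0; 0,-1,0,0; 0,0,-1,0; 0,1,0,-1])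
    (u := !![1,0,0,0; β,1,0,0; 0,σ β,1,-σ β; β,0,0,1]) ?_ ?_ ?_ ?_ (mem_Utilde σ ?_ ?_ ?_ ?_ ?_ ?_ ?_ ?_) ?_
  case refine_1 =>
    ext i j
    fin_cases i <;> fin_cases j <;> simp [JmatL, Matrix.mul_apply, Fin.sum_univ_four]
  case refine_5 =>
    ext i j
    fin_cases i <;> fin_cases j <;> simp [JmatL, Matrix.mul_apply, Fin.sum_univ_four, hinv]
  case refine_6 =>
    intro i j
    fin_cases i <;> fin_cases j <;> simp [hσnorm, hβ.le]
  case refine_7 => simp [Matrix.det_succ_row_zero, Fin.sum_univ_succ, Fin.succAbove]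
  case refine_13 =>
    rw [mapL_t3]
    ext i j
    fin_cases i <;> fin_cases j <;> simp [shear, Matrix.mul_apply, Fin.sum_univ_four]
  all_goals simp [hσnorm, hβ]

lemma h_mul_shear_mul_t5_mem (σ : L ≃+* L) (l : ℤ) (m : ℕ) (β : L)
    (hinv : ∀ x, σ (σ x) = x) (hσnorm : ∀ x, ‖σ x‖ = ‖x‖) (hβ : ‖β‖ ≤ 1) :
    mapL p L (hmat p l m) * (shear β (σ β) * mapL p L (t5 p)) ∈ PUtilde p L σ := by
  refine mem_PUtilde_of_eq σ l m (q := 1)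
    (u := !![-1,0,0,0; -β,-1,0,0; 0,0,-1,σ β; 0,0,0,-1]) ?_ ?_ ?_ ?_ (mem_Utilde σ ?_ ?_ ?_ ?_ ?_ ?_ ?_ ?_) ?_
  case refine_1 =>
    simp
  case refine_5 =>
    ext i j
    fin_cases i <;> fin_cases j <;> simp [JmatL, Matrix.mul_apply, Fin.sum_univ_four, hinv]
  case refine_6 =>
    intro i j
    fin_cases i <;> fin_cases j <;> simp [hσnorm, hβ]
  case refine_7 => simp [Matrix.det_succ_row_zero, Fin.sum_univ_succ, Fin.succAbove]
  case refine_13 =>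
    rw [mapL_t5]
    ext i j
    fin_cases i <;> fin_cases j <;> simp [shear, Matrix.mul_apply, Fin.sum_univ_four]
  all_goals simp

lemma h_mul_shear_mul_t7_mem (σ : L ≃+* L) (l : ℤ) (m : ℕ) (β : L)
    (hinv : ∀ x, σ (σ x) = x) (hσnorm : ∀ x, ‖σ x‖ = ‖x‖) (hβ : ‖β‖ < 1) :
    mapL p L (hmat p l m) * (shear β (σ β) * mapL p L (t7 p)) ∈ PUtilde p L σ := by
  refine mem_PUtilde_of_eq σ l m (q := !![1,0,0,0; 0,0,0,1; 0,0,1,0; 0,-1,0,0])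
    (u := !![0,0,1,0; 0,1,0,0; -1,σ β,0,0; 0,0,β,1]) ?_ ?_ ?_ ?_ (mem_Utilde σ ?_ ?_ ?_ ?_ ?_ ?_ ?_ ?_) ?_
  case refine_1 =>
    ext i j
    fin_cases i <;> fin_cases j <;> simp [JmatL, Matrix.mul_apply, Fin.sum_univ_four]
  case refine_5 =>
    ext i j
    fin_cases i <;> fin_cases j <;> simp [JmatL, Matrix.mul_apply, Fin.sum_univ_four, hinv]
  case refine_6 =>
    intro i j
    fin_cases i <;> fin_cases j <;> simp [hσnorm, hβ.le]
  case refine_7 => simp [Matrix.det_succ_row_zero, Fin.sum_univ_succ, Fin.succAbove]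
  case refine_13 =>
    rw [mapL_t7]
    ext i j
    fin_cases i <;> fin_cases j <;> simp [shear, Matrix.mul_apply, Fin.sum_univ_four]
  all_goals simp [hσnorm, hβ]

end Helpers

theorem theta_h_t_membership_PU
    (σ : L ≃+* L) (sqd : L) (a b c : ℚ_[p])
    (hσalg : ∀ x : ℚ_[p], σ (algebraMap ℚ_[p] L x) = algebraMap ℚ_[p] L x)
    (hσsqd : σ sqd = -sqd)
    (hsqd : sqd ^ 2 = algebraMap ℚ_[p] L (b ^ 2 - 4 * a * c))
    (hspan : ∀ x : L, ∃ u v : ℚ_[p],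
      x = algebraMap ℚ_[p] L u + algebraMap ℚ_[p] L v * sqd)
    (hnorm : ∀ u v : ℚ_[p],
      ‖algebraMap ℚ_[p] L u + algebraMap ℚ_[p] L v * sqd‖ = max ‖u‖ ‖v‖)
    (ha : ‖a‖ = 1) (hb : ‖b‖ ≤ 1) (hc : ‖c‖ = 1)
    (hd : ‖b ^ 2 - 4 * a * c‖ = 1)
    (hnsq : ∀ z : ℚ_[p], z ^ 2 ≠ b ^ 2 - 4 * a * c) :
    (∀ (l : ℤ) (m : ℕ), 0 < m →
      (Theta p L σ sqd b c * mapL p L (hmat p l m * t1 p) ∈ PUtilde p L σ ∧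
       Theta p L σ sqd b c * mapL p L (hmat p l m * t3 p) ∈ PUtilde p L σ ∧
       Theta p L σ sqd b c * mapL p L (hmat p l m * t5 p) ∈ PUtilde p L σ ∧
       Theta p L σ sqd b c * mapL p L (hmat p l m * t7 p) ∈ PUtilde p L σ) ∧
      (Theta p L σ sqd b c * mapL p L (hmat p l m * t2 p) ∉ PUtilde p L σ ∧
       Theta p L σ sqd b c * mapL p L (hmat p l m * t4 p) ∉ PUtilde p L σ ∧
       Theta p L σ sqd b c * mapL p L (hmat p l m * t6 p) ∉ PUtilde p L σ ∧
       Theta p L σ sqd b c * mapL p L (hmat p l m * t8 p) ∉ PUtilde p L σ)) ∧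
    (∀ l : ℤ,
      (Theta p L σ sqd b c * mapL p L (hmat p l 0 * t1 p) ∈ PUtilde p L σ ∧
       Theta p L σ sqd b c * mapL p L (hmat p l 0 * t5 p) ∈ PUtilde p L σ) ∧
      (Theta p L σ sqd b c * mapL p L (hmat p l 0 * t2 p) ∉ PUtilde p L σ ∧
       Theta p L σ sqd b c * mapL p L (hmat p l 0 * t7 p) ∉ PUtilde p L σ)) := by
  have hinv (x : L) : σ (σ x) = x := by
    obtain ⟨u, v, rfl⟩ := hspan x
    simp [hσalg, hσsqd]
  have hσnorm (x : L) : ‖σ x‖ = ‖x‖ := by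
    obtain ⟨u, v, rfl⟩ := hspan x
    have h := hnorm u (-v)
    simp only [map_neg, norm_neg] at h
    simpa [hσalg, hσsqd, hnorm] using h
  have halg (x : ℚ_[p]) : ‖algebraMap ℚ_[p] L x‖ = ‖x‖ := by
    simpa using hnorm x 0
  have : IsUltrametricDist L := by
    refine IsUltrametricDist.isUltrametricDist_of_forall_norm_add_le_max_norm fun x y => ?_
    obtain ⟨u, v, rfl⟩ := hspan x
    obtain ⟨u', v', rfl⟩ := hspan y
    have h := hnorm (u + u') (v + v')
    rw [show algebraMap ℚ_[p] L u + algebraMap ℚ_[p] L v * sqd +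
      (algebraMap ℚ_[p] L u' + algebraMap ℚ_[p] L v' * sqd) =
      algebraMap ℚ_[p] L (u + u') + algebraMap ℚ_[p] L (v + v') * sqd by simp; ring,
      hnorm, hnorm, hnorm]
    refine max_le ((IsUltrametricDist.norm_add_le_max u u').trans ?_)
      ((IsUltrametricDist.norm_add_le_max v v').trans ?_)
    · exact max_le_max (le_max_left _ _) (le_max_left _ _)
    · exact max_le_max (le_max_right _ _) (le_max_right _ _)
  have hbs : ‖algebraMap ℚ_[p] L b + sqd‖ = 1 := by
    simpa [hb] using hnorm b 1
  -- `p` is odd: `(b + √-d) (b - √-d) = 4 a c`, and both factors on the left are units.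
  have h2 : ‖(2 : ℚ_[p])‖ = 1 := by
    have hbs' : ‖algebraMap ℚ_[p] L b - sqd‖ = 1 := by
      simpa [hb, sub_eq_add_neg] using hnorm b (-1)
    have hprod : (algebraMap ℚ_[p] L b + sqd) * (algebraMap ℚ_[p] L b - sqd) =
        algebraMap ℚ_[p] L (2 ^ 2 * a * c) := by
      simp only [map_sub, map_mul, map_pow, map_ofNat] at hsqd ⊢
      linear_combination -hsqd
    have := congrArg norm hprod
    rw [norm_mul, hbs, hbs', halg, norm_mul, norm_mul, ha, hc, norm_pow] at this
    have h0 := norm_nonneg (2 : ℚ_[p])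
    nlinarith
  set α : L := (algebraMap ℚ_[p] L b + sqd) / (2 * algebraMap ℚ_[p] L c) with hα
  have hαn : ‖α‖ = 1 := by
    have : ‖(2 : L)‖ = 1 := by rw [← map_ofNat (algebraMap ℚ_[p] L) 2, halg, h2]
    simp [hα, hbs, this, halg, hc]
  have hpn : ‖(p : L)‖ < 1 := by
    have := halg p
    rw [map_natCast] at this
    rw [this]
    exact Padic.norm_p_lt_one
  have key (l : ℤ) (m : ℕ) (t : Matrix (Fin 4) (Fin 4) ℚ_[p]) :
      Theta p L σ sqd b c * mapL p L (hmat p l m * t) =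
        mapL p L (hmat p l m) * (shear ((p : L) ^ m * α) (σ ((p : L) ^ m * α)) * mapL p L t) := by
    rw [mapL_mul, ← Matrix.mul_assoc, Theta_mul_hmat σ sqd b c l m _ rfl, Matrix.mul_assoc]
  simp only [key]
  have hβ (m : ℕ) : ‖(p : L) ^ m * α‖ ≤ 1 := by
    rw [norm_mul, norm_pow, hαn, mul_one]
    exact pow_le_one₀ (norm_nonneg _) hpn.le
  have hβlt (m : ℕ) (hm : 0 < m) : ‖(p : L) ^ m * α‖ < 1 := by
    rw [norm_mul, norm_pow, hαn, mul_one]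
    exact pow_lt_one₀ (norm_nonneg _) hpn hm.ne'
  refine ⟨fun l m hm => ?_, fun l => ?_⟩
  · have hb1 := hβlt m hm
    generalize (p : L) ^ m * α = β at hb1 ⊢
    refine ⟨⟨h_mul_shear_mul_t1_mem σ l m β hinv hσnorm hb1.le, h_mul_shear_mul_t3_mem σ l m β hinv hσnorm hb1,
      h_mul_shear_mul_t5_mem σ l m β hinv hσnorm hb1.le, h_mul_shear_mul_t7_mem σ l m β hinv hσnorm hb1⟩, ?_⟩
    refine ⟨fun h => ?_, fun h => ?_, fun h => ?_, fun h => ?_⟩ <;>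
    · have hr := row_bound_of_mem_PUtilde σ h
      simp only [third_row, mapL_t2, mapL_t4, mapL_t6, mapL_t8] at hr
      simp [hσnorm] at hr
      grind
  · have hb1 := hβ 0
    have hb2 : ‖(p : L) ^ 0 * α‖ = 1 := by simpa using hαn
    generalize (p : L) ^ 0 * α = β at hb1 hb2 ⊢
    refine ⟨⟨h_mul_shear_mul_t1_mem σ l 0 β hinv hσnorm hb1, h_mul_shear_mul_t5_mem σ l 0 β hinv hσnorm hb1⟩, ?_⟩
    refine ⟨fun h => ?_, fun h => ?_⟩ <;>
    · have hr := row_bound_of_mem_PUtilde σ h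
      simp only [third_row, mapL_t2, mapL_t7] at hr
      simp [hσnorm, hb2] at hr
end
end
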